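/- Assume the standing hypotheses on g₀, g₁, …, g_m and the compact sets U, V. Let 0 < S̃ < ∞, S̃ ≤ S ≤ +∞, T̃ > 0, (φ₀,φ) : [0,S) → ℝ₊ × U be 1-Lipschitz with φ₀ nondecreasing, φ₀(0)=0, φ₀'+|φ'| = 1 a.e., and v : [0,T̃] → V measurable with φ₀(S̃) = T̃. Suppose (φ₀ₕ,φₕ), h ∈ ℕ, are 1-Lipschitz maps [0,S) → ℝ₊ × U with φ₀ₕ strictly increasing, φ₀ₕ(0)=0, φ₀ₕ(S̃) = T̃, φ₀ₕ'+|φₕ'| ≤ 1 a.e., and sup_{s∈[0,S̃]} |(φ₀ₕ,φₕ)(s) − (φ₀,φ)(s)| → 0 as h → ∞. Let ξ and ξₕ be the space-time solutions with initial datum x̄₀ corresponding to (φ₀,φ,v∘φ₀) and (φ₀ₕ,φₕ,v∘φ₀ₕ) respectively. Then there is a subsequence of (ξₕ) converging uniformly to ξ on [0,S̃]. -/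

import Mathlib

open MeasureTheory Set Filter Topology
open scoped ENNReal

noncomputable section

/-- Standing hypotheses on the data of the impulsive control system. -/
def StandingHyp {n m q : ℕ} (U : Set (EuclideanSpace ℝ (Fin m)))
    (V : Set (EuclideanSpace ℝ (Fin q)))
    (g0 : EuclideanSpace ℝ (Fin n) → EuclideanSpace ℝ (Fin m) → EuclideanSpace ℝ (Fin q) →
      EuclideanSpace ℝ (Fin n))
    (g : Fin m → EuclideanSpace ℝ (Fin n) → EuclideanSpace ℝ (Fin m) →
      EuclideanSpace ℝ (Fin n))
    (M : ℝ) : Prop :=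
  IsCompact U ∧ IsCompact V ∧
  -- g₀ continuous on ℝⁿ × U × V
  ContinuousOn (fun p : (EuclideanSpace ℝ (Fin n) × EuclideanSpace ℝ (Fin m)) ×
      EuclideanSpace ℝ (Fin q) => g0 p.1.1 p.1.2 p.2) ((univ ×ˢ U) ×ˢ V) ∧
  -- (x,u) ↦ g₀(x,u,v) locally Lipschitz, uniformly in v ∈ V
  (∀ R > (0:ℝ), ∃ L ≥ (0:ℝ), ∀ v' ∈ V, ∀ x1 x2 : EuclideanSpace ℝ (Fin n),
    ∀ u1 ∈ U, ∀ u2 ∈ U, ‖x1‖ ≤ R → ‖x2‖ ≤ R →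
      ‖g0 x1 u1 v' - g0 x2 u2 v'‖ ≤ L * (‖x1 - x2‖ + ‖u1 - u2‖)) ∧
  -- each gᵢ locally Lipschitz
  (∀ i : Fin m, ∀ R > (0:ℝ), ∃ L ≥ (0:ℝ), ∀ x1 x2 : EuclideanSpace ℝ (Fin n),
    ∀ u1 ∈ U, ∀ u2 ∈ U, ‖x1‖ ≤ R → ‖x2‖ ≤ R →
      ‖g i x1 u1 - g i x2 u2‖ ≤ L * (‖x1 - x2‖ + ‖u1 - u2‖)) ∧
  -- sublinear growth: |(g₀,g₁,…,g_m)| ≤ M(1+|(x,u)|)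
  0 < M ∧
  ∀ (x : EuclideanSpace ℝ (Fin n)), ∀ u' ∈ U, ∀ v' ∈ V,
    Real.sqrt (‖g0 x u' v'‖ ^ 2 + ∑ i, ‖g i x u'‖ ^ 2) ≤
      M * (1 + Real.sqrt (‖x‖ ^ 2 + ‖u'‖ ^ 2))

/-- `ξ` is a space-time solution with initial datum `x0` corresponding to `(φ₀,φ,ψ)`,
on the domain `D`. -/
def IsSTSol {n m q : ℕ}
    (g0 : EuclideanSpace ℝ (Fin n) → EuclideanSpace ℝ (Fin m) → EuclideanSpace ℝ (Fin q) →
      EuclideanSpace ℝ (Fin n))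
    (g : Fin m → EuclideanSpace ℝ (Fin n) → EuclideanSpace ℝ (Fin m) →
      EuclideanSpace ℝ (Fin n))
    (x0 : EuclideanSpace ℝ (Fin n)) (phi0 : ℝ → ℝ) (phi : ℝ → EuclideanSpace ℝ (Fin m))
    (psi : ℝ → EuclideanSpace ℝ (Fin q)) (xi : ℝ → EuclideanSpace ℝ (Fin n))
    (D : Set ℝ) : Prop :=
  ∀ s ∈ D, xi s = x0 + ∫ r in (0:ℝ)..s,
    ((deriv phi0 r) • g0 (xi r) (phi r) (psi r) +
      ∑ i, ((deriv phi r) i) • g i (xi r) (phi r))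

section helpers

variable {E : Type*} [NormedAddCommGroup E] [NormedSpace ℝ E]

lemma aux_ae_Ioo {a b : ℝ} {P : ℝ → Prop} (h : ∀ r ∈ Ioo a b, P r) :
    ∀ᵐ r ∂volume, r ∈ Ioc a b → P r := by
  have h1 : ∀ᵐ r ∂(volume : Measure ℝ), r ≠ b := by
    simp [ae_iff, measure_singleton]
  filter_upwards [h1] with r hr hr2
  exact h r ⟨hr2.1, lt_of_le_of_ne hr2.2 hr⟩

lemma aux_norm_int {a b C : ℝ} (hab : a ≤ b) {f : ℝ → E} (h : ∀ r ∈ Ioo a b, ‖f r‖ ≤ C) :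
    ‖∫ r in a..b, f r‖ ≤ C * (b - a) := by
  have := intervalIntegral.norm_integral_le_of_norm_le_const_ae (a := a) (b := b) (C := C) (f := f)
    (by rw [uIoc_of_le hab]; exact aux_ae_Ioo h)
  rwa [abs_of_nonneg (by linarith)] at this

lemma aux_ii {a b C : ℝ} (hab : a ≤ b) {f : ℝ → E} (h : ∀ r ∈ Ioo a b, ‖f r‖ ≤ C)
    (hm : AEStronglyMeasurable f (volume.restrict (Ioo a b))) :
    IntervalIntegrable f volume a b := by
  rw [intervalIntegrable_iff_integrableOn_Ioo_of_le hab]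
  refine IntegrableOn.of_bound (by simp) hm C ?_
  exact (ae_restrict_iff' measurableSet_Ioo).2 (Eventually.of_forall h)

lemma aux_gronwall {S A K : ℝ} (hK : 0 ≤ K) {u : ℝ → ℝ}
    (hu : ContinuousOn u (Icc 0 S)) (hu0 : ∀ t ∈ Icc 0 S, 0 ≤ u t)
    (h : ∀ t ∈ Icc 0 S, u t ≤ A + K * ∫ r in (0:ℝ)..t, u r) :
    ∀ t ∈ Icc 0 S, u t ≤ A * Real.exp (K * t) := by
  intro t ht
  have hS : 0 ≤ S := ht.1.trans ht.2
  have hint : ∀ s ∈ Icc 0 S, IntervalIntegrable u volume 0 s := fun s hs =>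
    (hu.mono (by rw [uIcc_of_le hs.1]; exact Icc_subset_Icc_right hs.2)).intervalIntegrable
  have hA : 0 ≤ A := by
    have := h 0 ⟨le_rfl, hS⟩
    have h2 := hu0 0 ⟨le_rfl, hS⟩
    simp at this; linarith
  set y : ℝ → ℝ := fun t => A + K * ∫ r in (0:ℝ)..t, u r with hy
  have hy0 : ∀ s ∈ Icc 0 S, 0 ≤ y s := fun s hs => (hu0 s hs).trans (h s hs)
  have hyc : ContinuousOn y (Icc 0 S) := by
    have := intervalIntegral.continuousOn_primitive_interval' (hint S ⟨hS, le_rfl⟩) left_mem_uIcc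
    rw [uIcc_of_le hS] at this
    exact continuousOn_const.add (continuousOn_const.mul this)
  have hyd : ∀ x ∈ Ico 0 S, HasDerivWithinAt y (K * u x) (Ici x) x := by
    intro x hx
    have hxI : x ∈ Icc 0 S := ⟨hx.1, hx.2.le⟩
    have hnh : Icc 0 S ∈ 𝓝[>] x :=
      mem_of_superset (Ioc_mem_nhdsGT hx.2) (fun z hz => ⟨hx.1.trans hz.1.le, hz.2⟩)
    have hd : HasDerivWithinAt (fun t => ∫ r in (0:ℝ)..t, u r) (u x) (Ici x) x := by
      refine intervalIntegral.integral_hasDerivWithinAt_right (hint x hxI) (t := Ioi x) ?_ ?_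
      · exact ⟨Icc 0 S, hnh, hu.aestronglyMeasurable measurableSet_Icc⟩
      · exact (hu x hxI).mono_of_mem_nhdsWithin hnh
    exact (hd.const_mul K).const_add A
  have := norm_le_gronwallBound_of_norm_deriv_right_le (δ := A) (K := K) (ε := 0) hyc hyd
    (by simp [hy, abs_of_nonneg hA]) (by
      intro x hx
      have hxI : x ∈ Icc 0 S := ⟨hx.1, hx.2.le⟩
      rw [Real.norm_of_nonneg (mul_nonneg hK (hu0 x hxI)), Real.norm_of_nonneg (hy0 x hxI), add_zero]
      exact mul_le_mul_of_nonneg_left (h x hxI) hK) t ht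
  rw [gronwallBound_ε0, sub_zero, Real.norm_of_nonneg (hy0 t ht)] at this
  exact (h t ht).trans this

lemma aux_apriori [CompleteSpace E] {S C : ℝ} (hS : 0 ≤ S) (hC : 0 ≤ C) {f xi : ℝ → E} {x0 : E}
    (hxi : ∀ s ∈ Icc 0 S, xi s = x0 + ∫ r in (0:ℝ)..s, f r)
    (hf : ∀ r ∈ Ioo 0 S, ‖f r‖ ≤ C * (1 + ‖xi r‖))
    (hm : AEStronglyMeasurable xi (volume.restrict (Ioo 0 S)) →
      AEStronglyMeasurable f (volume.restrict (Ioo 0 S))) :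
    IntervalIntegrable f volume 0 S ∧ ContinuousOn xi (Icc 0 S) ∧
      ∀ s ∈ Icc 0 S, ‖xi s‖ ≤ (1 + ‖x0‖) * Real.exp (C * S) := by
  have key1 : ∀ s ∈ Icc 0 S, IntervalIntegrable f volume 0 s → ContinuousOn xi (Icc 0 s) := by
    intro s hs hi
    have := intervalIntegral.continuousOn_primitive_interval' hi left_mem_uIcc
    rw [uIcc_of_le hs.1] at this
    refine (continuousOn_const (c := x0)).add this |>.congr ?_
    intro t ht
    exact hxi t ⟨ht.1, ht.2.trans hs.2⟩
  have hexp : ∀ s ∈ Icc 0 S, (1 + ‖x0‖) * Real.exp (C * s) ≤ (1 + ‖x0‖) * Real.exp (C * S) := by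
    intro s hs
    have := mul_le_mul_of_nonneg_left hs.2 hC
    gcongr
  have key2 : ∀ s ∈ Icc 0 S, IntervalIntegrable f volume 0 s →
      ‖xi s‖ ≤ (1 + ‖x0‖) * Real.exp (C * S) := by
    intro s hs hi
    have hc := key1 s hs hi
    have hcu : ContinuousOn (fun t => 1 + ‖xi t‖) (Icc 0 s) := continuousOn_const.add hc.norm
    have := aux_gronwall (A := 1 + ‖x0‖) hC hcu
      (fun t _ => by positivity) (by
        intro t ht
        have htS : t ∈ Icc 0 S := ⟨ht.1, ht.2.trans hs.2⟩
        have h1 : ‖∫ r in (0:ℝ)..t, f r‖ ≤ ∫ r in (0:ℝ)..t, C * (1 + ‖xi r‖) := by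
          refine intervalIntegral.norm_integral_le_of_norm_le ht.1 ?_ ?_
          · exact aux_ae_Ioo (fun r hr => hf r ⟨hr.1, hr.2.trans_le htS.2⟩)
          · refine ContinuousOn.intervalIntegrable ?_
            rw [uIcc_of_le ht.1]
            exact continuousOn_const.mul (hcu.mono (Icc_subset_Icc_right ht.2))
        rw [intervalIntegral.integral_const_mul] at h1
        rw [hxi t htS]
        have := norm_add_le x0 (∫ r in (0:ℝ)..t, f r)
        linarith) s ⟨hs.1, le_rfl⟩
    have h2 := hexp s hs
    linarith
  set A : Set ℝ := {s | s ∈ Icc 0 S ∧ IntervalIntegrable f volume 0 s} with hA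
  have hdown : ∀ s ∈ A, ∀ t, 0 ≤ t → t ≤ s → t ∈ A := by
    rintro s ⟨hs, hi⟩ t h0 hts
    refine ⟨⟨h0, hts.trans hs.2⟩, hi.mono_set ?_⟩
    rw [uIcc_of_le h0, uIcc_of_le hs.1]
    exact Icc_subset_Icc_right hts
  have hAm : MeasurableSet A := by
    refine OrdConnected.measurableSet ⟨?_⟩
    intro x hx y hy z hz
    exact hdown y hy z (hx.1.1.trans hz.1) hz.2
  have hAc : ContinuousOn xi A := by
    intro t ht
    by_cases hex : ∃ t' ∈ A, t < t'
    · obtain ⟨t', ht', hlt⟩ := hex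
      refine ((key1 t' ht'.1 ht'.2) t ⟨ht.1.1, hlt.le⟩).mono_of_mem_nhdsWithin ?_
      have : Iio t' ∈ 𝓝[A] t := mem_nhdsWithin_of_mem_nhds (Iio_mem_nhds hlt)
      filter_upwards [this, self_mem_nhdsWithin] with z hz hzA
      exact ⟨hzA.1.1, le_of_lt hz⟩
    · push Not at hex
      exact ((key1 t ht.1 ht.2) t ⟨ht.1.1, le_rfl⟩).mono (fun z hz => ⟨hz.1.1, hex z hz⟩)
  have hconst : ∀ s ∈ Icc 0 S, s ∉ A → xi s = x0 := by
    intro s hs hsA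
    rw [hxi s hs, intervalIntegral.integral_undef (fun h => hsA ⟨hs, h⟩), add_zero]
  have hx0 : ‖x0‖ ≤ (1 + ‖x0‖) * Real.exp (C * S) := by
    have : 1 ≤ Real.exp (C * S) := Real.one_le_exp (by positivity)
    nlinarith [norm_nonneg x0]
  have hbd : ∀ s ∈ Icc 0 S, ‖xi s‖ ≤ (1 + ‖x0‖) * Real.exp (C * S) := by
    intro s hs
    by_cases hsA : s ∈ A
    · exact key2 s hs hsA.2
    · rw [hconst s hs hsA]; exact hx0
  have hxm : AEStronglyMeasurable xi (volume.restrict (Ioo 0 S)) := by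
    have e : Ioo 0 S = (Ioo 0 S ∩ A) ∪ (Ioo 0 S \ A) := (inter_union_sdiff _ _).symm
    rw [e, aestronglyMeasurable_union_iff]
    constructor
    · exact (hAc.mono inter_subset_right).aestronglyMeasurable (measurableSet_Ioo.inter hAm)
    · refine (aestronglyMeasurable_const (b := x0)).congr ?_
      refine (ae_restrict_iff' (measurableSet_Ioo.diff hAm)).2 (Eventually.of_forall ?_)
      intro s hs
      exact (hconst s (Ioo_subset_Icc_self hs.1) hs.2).symm
  have hfin : IntervalIntegrable f volume 0 S := by
    refine aux_ii hS (C := C * (1 + (1 + ‖x0‖) * Real.exp (C * S))) ?_ (hm hxm)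
    intro r hr
    refine (hf r hr).trans ?_
    have := hbd r (Ioo_subset_Icc_self hr)
    gcongr
  exact ⟨hfin, key1 S ⟨hS, le_rfl⟩ hfin, hbd⟩

/-- change of variables for monotone Lipschitz functions -/
lemma aux_cov {S : ℝ} {p : ℝ → ℝ} (hl : LipschitzOnWith 1 p (Icc 0 S))
    (hmo : MonotoneOn p (Icc 0 S)) (w : ℝ → E) {s : ℝ} (hs : s ∈ Icc 0 S) :
    ∫ r in (0:ℝ)..s, deriv p r • w (p r) = ∫ t in (p 0)..(p s), w t := by
  have hsub : Icc 0 s ⊆ Icc 0 S := Icc_subset_Icc_right hs.2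
  have hl' := hl.mono hsub
  have hmo' := hmo.mono hsub
  have hps : p 0 ≤ p s := hmo' ⟨le_rfl, hs.1⟩ ⟨hs.1, le_rfl⟩ hs.1
  set D : Set ℝ := Ioo 0 s ∩ {x | DifferentiableAt ℝ p x} with hD
  have hDm : MeasurableSet D := measurableSet_Ioo.inter (measurableSet_of_differentiableAt ℝ p)
  have hDI : D ⊆ Icc 0 s := fun x hx => Ioo_subset_Icc_self hx.1
  have hnull : volume (Icc 0 s \ D) = 0 := by
    have h1 := hl'.ae_differentiableWithinAt_of_mem_real
    have h2 : ∀ᵐ r ∂(volume : Measure ℝ), r ≠ 0 := by simp [ae_iff, measure_singleton]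
    have h3 : ∀ᵐ r ∂(volume : Measure ℝ), r ≠ s := by simp [ae_iff, measure_singleton]
    have h4 : ∀ᵐ r ∂(volume : Measure ℝ), r ∉ Icc 0 s \ D := by
      filter_upwards [h1, h2, h3] with r hr1 hr2 hr3 hr
      have hI : r ∈ Ioo 0 s := ⟨lt_of_le_of_ne hr.1.1 hr2.symm, lt_of_le_of_ne hr.1.2 hr3⟩
      exact hr.2 ⟨hI, (hr1 hr.1).differentiableAt (Icc_mem_nhds hI.1 hI.2)⟩
    exact measure_eq_zero_iff_ae_notMem.2 h4
  have hnull2 : volume (p '' (Icc 0 s \ D)) = 0 := by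
    have := (hl'.mono (sdiff_subset (s := Icc 0 s) (t := D))).hausdorffMeasure_image_le zero_le_one
    rw [hausdorffMeasure_real, hnull, mul_zero] at this
    exact le_antisymm this (zero_le)
  have him : p '' Icc 0 s = Icc (p 0) (p s) :=
    hl'.continuousOn.image_Icc_of_monotoneOn hs.1 hmo'
  rw [intervalIntegral.integral_of_le hs.1, intervalIntegral.integral_of_le hps,
    ← integral_Icc_eq_integral_Ioc, ← integral_Icc_eq_integral_Ioc]
  have e1 : (Icc 0 s : Set ℝ) =ᵐ[volume] D := by
    refine (ae_eq_set).2 ⟨hnull, ?_⟩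
    rw [sdiff_eq_empty.2 hDI]; simp
  have e2 : (Icc (p 0) (p s) : Set ℝ) =ᵐ[volume] p '' D := by
    refine (ae_eq_set).2 ⟨measure_mono_null ?_ hnull2, ?_⟩
    · rw [← him]; 
      rintro _ ⟨⟨x, hx, rfl⟩, hx2⟩
      exact ⟨x, ⟨hx, fun hxD => hx2 ⟨x, hxD, rfl⟩⟩, rfl⟩
    · rw [← him, sdiff_eq_empty.2 (image_mono hDI)]; simp
  rw [setIntegral_congr_set e1, setIntegral_congr_set e2]
  symm
  exact integral_image_eq_integral_deriv_smul_of_monotoneOn hDm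
    (fun x hx => hx.2.hasDerivAt.hasDerivWithinAt) (hmo'.mono hDI) w

lemma aux_ftc {m : ℕ} {S : ℝ} {p : ℝ → EuclideanSpace ℝ (Fin m)}
    (hl : LipschitzOnWith 1 p (Icc 0 S)) (i : Fin m) {s : ℝ} (hs : s ∈ Icc 0 S) :
    ∫ r in (0:ℝ)..s, (deriv p r) i = p s i - p 0 i := by
  have hl' := hl.mono (Icc_subset_Icc_right hs.2 : Icc 0 s ⊆ Icc 0 S)
  have hli : LipschitzOnWith 1 (fun r => p r i) (uIcc 0 s) := by
    rw [uIcc_of_le hs.1]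
    refine LipschitzOnWith.of_dist_le_mul ?_
    intro x hx y hy
    refine le_trans ?_ (hl'.dist_le_mul x hx y hy)
    rw [dist_eq_norm, dist_eq_norm]
    exact PiLp.norm_apply_le (p x - p y) i
  rw [← hli.absolutelyContinuousOnInterval.integral_deriv_eq_sub]
  refine intervalIntegral.integral_congr_ae ?_
  rw [uIoc_of_le hs.1]
  have h1 := hl'.ae_differentiableWithinAt_of_mem_real
  have h3 : ∀ᵐ r ∂(volume : Measure ℝ), r ≠ s := by simp [ae_iff, measure_singleton]
  filter_upwards [h1, h3] with r hr1 hr3 hr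
  have hd : DifferentiableAt ℝ p r :=
    (hr1 ⟨hr.1.le, hr.2⟩).differentiableAt (Icc_mem_nhds hr.1 (lt_of_le_of_ne hr.2 hr3))
  have := (EuclideanSpace.proj (𝕜 := ℝ) i).hasFDerivAt.comp_hasDerivAt r hd.hasDerivAt
  exact this.deriv.symm

/-- freezing lemma -/
lemma aux_freeze [CompleteSpace E] {S C : ℝ} (hS : 0 < S) (hC : 0 ≤ C) (d : ℕ → ℝ → ℝ → E)
    (hLip : ∀ h, ∀ τ ∈ Icc 0 S, ∀ τ' ∈ Icc 0 S, ∀ r ∈ Ioo 0 S,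
      ‖d h τ r - d h τ' r‖ ≤ C * |τ - τ'|)
    (hii : ∀ h, ∀ τ ∈ Icc 0 S, IntervalIntegrable (d h τ) volume 0 S)
    (hdg : ∀ h, IntervalIntegrable (fun r => d h r r) volume 0 S)
    (hconv : ∀ τ ∈ Icc 0 S, ∀ ε > 0, ∀ᶠ h in atTop, ∀ s ∈ Icc 0 S,
      ‖∫ r in (0:ℝ)..s, d h τ r‖ ≤ ε) :
    ∀ ε > 0, ∀ᶠ h in atTop, ∀ s ∈ Icc 0 S, ‖∫ r in (0:ℝ)..s, d h r r‖ ≤ ε := by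
  have hsub : ∀ {f : ℝ → E}, IntervalIntegrable f volume 0 S → ∀ a ∈ Icc 0 S, ∀ b ∈ Icc 0 S,
      IntervalIntegrable f volume a b := by
    intro f hf a ha b hb
    refine hf.mono_set ?_
    rw [uIcc_of_le hS.le]
    exact uIcc_subset_Icc ha hb
  have step : ∀ δ > 0, ∀ j : ℕ, j * δ ≤ S → ∀ ε > 0, ∀ᶠ h in atTop, ∀ s ∈ Icc 0 S, s ≤ j * δ →
      ‖∫ r in (0:ℝ)..s, d h r r‖ ≤ ε + C * δ * s := by
    intro δ hδ j
    induction j with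
    | zero =>
      intro _ ε hε
      refine Eventually.of_forall ?_
      intro h s hs hs0
      have : s = 0 := le_antisymm (by simpa using hs0) hs.1
      subst this
      simp [hε.le]
    | succ j ih =>
      intro hj ε hε
      push_cast at hj
      have hjS : j * δ ≤ S := by nlinarith
      have hτ : (j * δ : ℝ) ∈ Icc 0 S := ⟨by positivity, hjS⟩
      filter_upwards [ih hjS (ε / 3) (by positivity), hconv _ hτ (ε / 3) (by positivity)]
        with h h1 h2 s hs hsj
      push_cast at hsj
      rcases le_total s (j * δ) with hle | hle
      · have := h1 s hs hle
        linarith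
      · have e0 : (0:ℝ) ∈ Icc 0 S := ⟨le_rfl, hS.le⟩
        have e1 := intervalIntegral.integral_add_adjacent_intervals
          (hsub (hdg h) 0 e0 _ hτ) (hsub (hdg h) _ hτ s hs)
        have e2 := intervalIntegral.integral_add_adjacent_intervals
          (hsub (hii h _ hτ) 0 e0 _ hτ) (hsub (hii h _ hτ) _ hτ s hs)
        have e3 := intervalIntegral.integral_sub
          (hsub (hdg h) _ hτ s hs) (hsub (hii h _ hτ) _ hτ s hs)
        have b3 : ‖∫ r in (j * δ)..s, (d h r r - d h (j * δ) r)‖ ≤ C * δ * (s - j * δ) := by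
          refine aux_norm_int hle ?_
          intro r hr
          have hrI : r ∈ Ioo 0 S := ⟨lt_of_le_of_lt hτ.1 hr.1, hr.2.trans_le hs.2⟩
          refine (hLip h r (Ioo_subset_Icc_self hrI) _ hτ r hrI).trans ?_
          refine mul_le_mul_of_nonneg_left ?_ hC
          rw [abs_of_nonneg (by linarith [hr.1])]
          linarith [hr.2]
        have b1 := h1 _ hτ le_rfl
        have b2 := h2 s hs
        have b2' := h2 _ hτ
        have hh : ∫ r in (0:ℝ)..s, d h r r = (∫ r in (0:ℝ)..(j * δ), d h r r)
            + (∫ r in (j * δ)..s, (d h r r - d h (j * δ) r))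
            + ((∫ r in (0:ℝ)..s, d h (j * δ) r) - ∫ r in (0:ℝ)..(j * δ), d h (j * δ) r) := by
          rw [e3, ← e1, ← e2]; abel
        have n1 := norm_add_le ((∫ r in (0:ℝ)..(j * δ), d h r r)
            + (∫ r in (j * δ)..s, (d h r r - d h (j * δ) r)))
            ((∫ r in (0:ℝ)..s, d h (j * δ) r) - ∫ r in (0:ℝ)..(j * δ), d h (j * δ) r)
        have n2 := norm_add_le (∫ r in (0:ℝ)..(j * δ), d h r r)
            (∫ r in (j * δ)..s, (d h r r - d h (j * δ) r))
        have n3 := norm_sub_le (∫ r in (0:ℝ)..s, d h (j * δ) r)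
          (∫ r in (0:ℝ)..(j * δ), d h (j * δ) r)
        rw [← hh] at n1
        have : C * δ * (s - j * δ) = C * δ * s - C * δ * (j * δ) := by ring
        linarith
  intro ε hε
  obtain ⟨N, hN⟩ := exists_nat_gt (2 * C * S * S / ε)
  have hNpos : (0:ℝ) < N + 1 := by positivity
  have hN1 : C * (S / (N + 1 : ℕ)) * S ≤ ε / 2 := by
    push_cast
    rw [div_lt_iff₀ hε] at hN
    have : C * (S / (N + 1)) * S = C * S * S / (N + 1) := by ring
    rw [this, div_le_iff₀ hNpos]
    nlinarith
  have hd : 0 < S / (N + 1 : ℕ) := by positivity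
  have hNe : ((N + 1 : ℕ) : ℝ) * (S / (N + 1 : ℕ)) = S := by
    field_simp
  filter_upwards [step _ hd (N + 1) hNe.le (ε / 2) (by positivity)] with h hh s hs
  have := hh s hs (by rw [hNe]; exact hs.2)
  have h5 : C * (S / (N + 1 : ℕ)) * s ≤ C * (S / (N + 1 : ℕ)) * S := by
    gcongr
    exact hs.2
  linarith

end helpers
section system

variable {n m q : ℕ}

local notation "Eu" k => EuclideanSpace ℝ (Fin k)

def stF (g0 : (Eu n) → (Eu m) → (Eu q) → (Eu n)) (g : Fin m → (Eu n) → (Eu m) → (Eu n))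
    (a : ℝ) (b : Eu m) (x : Eu n) (u : Eu m) (w : Eu q) : Eu n :=
  a • g0 x u w + ∑ i, (b i) • g i x u

variable {U : Set (Eu m)} {V : Set (Eu q)} {g0 : (Eu n) → (Eu m) → (Eu q) → (Eu n)}
  {g : Fin m → (Eu n) → (Eu m) → (Eu n)} {M : ℝ}

lemma aux_coord {k : ℕ} {b : Eu k} {c : ℝ} (hb : ‖b‖ ≤ c) (i : Fin k) : |b i| ≤ c :=
  (PiLp.norm_apply_le b i).trans hb

lemma stF_gbound (hst : StandingHyp U V g0 g M) :
    ∃ C ≥ (0:ℝ), ∀ x, ∀ u ∈ U, ∀ w ∈ V, ‖g0 x u w‖ ≤ C * (1 + ‖x‖) ∧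
      ∀ i, ‖g i x u‖ ≤ C * (1 + ‖x‖) := by
  obtain ⟨hU, hV, hc, hl0, hl, hM, hgr⟩ := hst
  obtain ⟨B, hB⟩ := hU.isBounded.exists_norm_le
  refine ⟨M * (1 + |B|), by positivity, ?_⟩
  intro x u hu w hw
  have h1 := hgr x u hu w hw
  have hb : ‖u‖ ≤ |B| := (hB u hu).trans (le_abs_self B)
  have h2 : Real.sqrt (‖x‖ ^ 2 + ‖u‖ ^ 2) ≤ ‖x‖ + ‖u‖ := by
    rw [Real.sqrt_le_left (by positivity)]
    nlinarith [norm_nonneg x, norm_nonneg u]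
  have h3 : M * (1 + Real.sqrt (‖x‖ ^ 2 + ‖u‖ ^ 2)) ≤ M * (1 + |B|) * (1 + ‖x‖) := by
    rw [mul_assoc]
    refine mul_le_mul_of_nonneg_left ?_ hM.le
    nlinarith [norm_nonneg x, abs_nonneg B]
  have hs : 0 ≤ ∑ i, ‖g i x u‖ ^ 2 := Finset.sum_nonneg (fun i _ => by positivity)
  refine ⟨?_, fun i => ?_⟩
  · refine le_trans ?_ (h1.trans h3)
    refine Real.le_sqrt_of_sq_le ?_
    linarith
  · refine le_trans ?_ (h1.trans h3)
    refine Real.le_sqrt_of_sq_le ?_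
    have := Finset.single_le_sum (f := fun i => ‖g i x u‖ ^ 2) (fun i _ => by positivity)
      (Finset.mem_univ i)
    nlinarith [sq_nonneg ‖g0 x u w‖]

lemma stF_norm_le {a : ℝ} {b : Eu m} (ha : |a| ≤ 1) (hb : ‖b‖ ≤ 1) (y0 : Eu n)
    (y : Fin m → Eu n) : ‖a • y0 + ∑ i, (b i) • y i‖ ≤ ‖y0‖ + ∑ i, ‖y i‖ := by
  refine (norm_add_le _ _).trans (add_le_add ?_ ((norm_sum_le _ _).trans ?_))
  · rw [norm_smul, Real.norm_eq_abs]
    exact mul_le_of_le_one_left (norm_nonneg _) ha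
  · refine Finset.sum_le_sum (fun i _ => ?_)
    rw [norm_smul, Real.norm_eq_abs]
    exact mul_le_of_le_one_left (norm_nonneg _) (aux_coord hb i)

lemma stF_bound (hst : StandingHyp U V g0 g M) :
    ∃ C ≥ (0:ℝ), ∀ a b x, ∀ u ∈ U, ∀ w ∈ V, |a| ≤ 1 → ‖b‖ ≤ 1 →
      ‖stF g0 g a b x u w‖ ≤ C * (1 + ‖x‖) := by
  obtain ⟨C, hC, h⟩ := stF_gbound hst
  refine ⟨(1 + m) * C, by positivity, ?_⟩
  intro a b x u hu w hw ha hb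
  obtain ⟨h1, h2⟩ := h x u hu w hw
  refine (stF_norm_le ha hb _ _).trans ?_
  have : ∑ i, ‖g i x u‖ ≤ ∑ i : Fin m, C * (1 + ‖x‖) := Finset.sum_le_sum (fun i _ => h2 i)
  rw [Finset.sum_const, Finset.card_univ, Fintype.card_fin, nsmul_eq_mul] at this
  linarith

lemma stF_lip (hst : StandingHyp U V g0 g M) (R : ℝ) (hR : 0 < R) :
    ∃ L ≥ (0:ℝ), ∀ a b x1 x2, ∀ u1 ∈ U, ∀ u2 ∈ U, ∀ w ∈ V, |a| ≤ 1 → ‖b‖ ≤ 1 →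
      ‖x1‖ ≤ R → ‖x2‖ ≤ R →
      ‖stF g0 g a b x1 u1 w - stF g0 g a b x2 u2 w‖ ≤ L * (‖x1 - x2‖ + ‖u1 - u2‖) := by
  obtain ⟨hU, hV, hc, hl0, hl, hM, hgr⟩ := hst
  obtain ⟨L0, hL0, h0⟩ := hl0 R hR
  choose L hL h using fun i => hl i R hR
  refine ⟨L0 + ∑ i, L i, add_nonneg hL0 (Finset.sum_nonneg (fun i _ => hL i)), ?_⟩
  intro a b x1 x2 u1 hu1 u2 hu2 w hw ha hb hx1 hx2
  have e : stF g0 g a b x1 u1 w - stF g0 g a b x2 u2 w =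
      a • (g0 x1 u1 w - g0 x2 u2 w) + ∑ i, b i • (g i x1 u1 - g i x2 u2) := by
    simp only [stF, smul_sub, Finset.sum_sub_distrib]
    abel
  rw [e, add_mul, Finset.sum_mul]
  refine (stF_norm_le ha hb _ _).trans (add_le_add (h0 w hw x1 x2 u1 hu1 u2 hu2 hx1 hx2) ?_)
  exact Finset.sum_le_sum (fun i _ => h i x1 x2 u1 hu1 u2 hu2 hx1 hx2)

lemma g_cont (hst : StandingHyp U V g0 g M) (i : Fin m) :
    ContinuousOn (fun p : (Eu n) × (Eu m) => g i p.1 p.2) (univ ×ˢ U) := by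
  obtain ⟨hU, hV, hc, hl0, hl, hM, hgr⟩ := hst
  rintro ⟨x, u⟩ ⟨-, hu⟩
  obtain ⟨L, hL, h⟩ := hl i (‖x‖ + 1) (by positivity)
  have key : ∀ᶠ p : (Eu n) × (Eu m) in 𝓝[univ ×ˢ U] (x, u),
      dist (g i p.1 p.2) (g i x u) ≤ L * (‖p.1 - x‖ + ‖p.2 - u‖) := by
    have hb : ∀ᶠ p : (Eu n) × (Eu m) in 𝓝[univ ×ˢ U] (x, u), ‖p.1‖ < ‖x‖ + 1 := by
      refine mem_nhdsWithin_of_mem_nhds ?_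
      exact (continuous_fst.norm.tendsto (x, u)).eventually (gt_mem_nhds (by simp))
    filter_upwards [hb, self_mem_nhdsWithin] with p hp hpU
    rw [dist_eq_norm]
    exact h p.1 x p.2 hpU.2 u hu hp.le (by linarith)
  refine tendsto_iff_dist_tendsto_zero.2 ?_
  refine squeeze_zero' (Eventually.of_forall fun _ => dist_nonneg) key ?_
  have hcc : Continuous (fun p : (Eu n) × (Eu m) => L * (‖p.1 - x‖ + ‖p.2 - u‖)) := by fun_prop
  have := hcc.tendsto (x, u)
  simp only [sub_self, norm_zero, add_zero, mul_zero] at this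
  exact this.mono_left nhdsWithin_le_nhds

lemma aux_comp_meas {α γ : Type*} [MeasurableSpace α] [TopologicalSpace γ] [MeasurableSpace γ]
    [BorelSpace γ] {f : γ → Eu n} {K : Set γ} (hf : ContinuousOn f K) (hK : MeasurableSet K)
    {μ : Measure α} {P : α → γ} (hP : AEMeasurable P μ) (hPK : ∀ᵐ r ∂μ, P r ∈ K) :
    AEStronglyMeasurable (fun r => f (P r)) μ := by
  classical
  have h1 : Measurable (K.piecewise f (fun _ => 0)) :=
    hf.measurable_piecewise continuousOn_const hK
  have h2 := (h1.comp_aemeasurable hP).aestronglyMeasurable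
  refine h2.congr ?_
  filter_upwards [hPK] with r hr
  simp [hr]

lemma stF_meas (hst : StandingHyp U V g0 g M) {S : ℝ} {a : ℝ → ℝ} {b : ℝ → Eu m}
    {x : ℝ → Eu n} {u : ℝ → Eu m} {w : ℝ → Eu q}
    (ha : Measurable a) (hb : Measurable b)
    (hx : AEMeasurable x (volume.restrict (Ioo 0 S)))
    (hu : AEMeasurable u (volume.restrict (Ioo 0 S)))
    (hw : AEMeasurable w (volume.restrict (Ioo 0 S)))
    (huU : ∀ r ∈ Ioo 0 S, u r ∈ U) (hwV : ∀ r ∈ Ioo 0 S, w r ∈ V) :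
    AEStronglyMeasurable (fun r => stF g0 g (a r) (b r) (x r) (u r) (w r))
      (volume.restrict (Ioo 0 S)) := by
  have hU := hst.1
  have hV := hst.2.1
  have hc := hst.2.2.1
  refine AEStronglyMeasurable.add ?_ ?_
  · refine ha.aestronglyMeasurable.smul ?_
    refine aux_comp_meas (P := fun r => ((x r, u r), w r)) hc
      ((MeasurableSet.univ.prod hU.measurableSet).prod hV.measurableSet) ?_ ?_
    · exact (hx.prodMk hu).prodMk hw
    · refine (ae_restrict_iff' measurableSet_Ioo).2 (Eventually.of_forall ?_)
      intro r hr
      exact ⟨⟨mem_univ _, huU r hr⟩, hwV r hr⟩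
  · refine Finset.aestronglyMeasurable_fun_sum _ (fun i _ => ?_)
    have hbi : Measurable (fun r => b r i) :=
      (EuclideanSpace.proj (𝕜 := ℝ) i).continuous.measurable.comp hb
    refine hbi.aestronglyMeasurable.smul ?_
    refine aux_comp_meas (P := fun r => (x r, u r)) (g_cont hst i)
      (MeasurableSet.univ.prod hU.measurableSet) (hx.prodMk hu) ?_
    refine (ae_restrict_iff' measurableSet_Ioo).2 (Eventually.of_forall ?_)
    intro r hr
    exact ⟨mem_univ _, huU r hr⟩

structure Ctl (U : Set (Eu m)) (S T : ℝ) (p0 : ℝ → ℝ) (p : ℝ → Eu m) : Prop where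
  pos : 0 < S
  lip : ∀ s1 ∈ Icc (0:ℝ) S, ∀ s2 ∈ Icc (0:ℝ) S, |p0 s1 - p0 s2| + ‖p s1 - p s2‖ ≤ |s1 - s2|
  mono : MonotoneOn p0 (Icc 0 S)
  h0 : p0 0 = 0
  hT : p0 S = T
  hU : ∀ s ∈ Icc (0:ℝ) S, p s ∈ U

namespace Ctl

variable {S T : ℝ} {p0 : ℝ → ℝ} {p : ℝ → Eu m} {v : ℝ → Eu q}

lemma lip0 (h : Ctl U S T p0 p) : LipschitzOnWith 1 p0 (Icc 0 S) := by
  refine LipschitzOnWith.of_dist_le_mul ?_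
  intro x hx y hy
  have := h.lip x hx y hy
  simp only [Real.dist_eq, NNReal.coe_one, one_mul]
  linarith [norm_nonneg (p x - p y)]

lemma lip1 (h : Ctl U S T p0 p) : LipschitzOnWith 1 p (Icc 0 S) := by
  refine LipschitzOnWith.of_dist_le_mul ?_
  intro x hx y hy
  have := h.lip x hx y hy
  simp only [dist_eq_norm, NNReal.coe_one, one_mul, Real.norm_eq_abs]
  linarith [abs_nonneg (p0 x - p0 y)]

lemma d0 (h : Ctl U S T p0 p) {r : ℝ} (hr : r ∈ Ioo 0 S) : |deriv p0 r| ≤ 1 := by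
  simpa using norm_deriv_le_of_lipschitzOn (Icc_mem_nhds hr.1 hr.2) h.lip0

lemma d1 (h : Ctl U S T p0 p) {r : ℝ} (hr : r ∈ Ioo 0 S) : ‖deriv p r‖ ≤ 1 := by
  simpa using norm_deriv_le_of_lipschitzOn (Icc_mem_nhds hr.1 hr.2) h.lip1

lemma mem (h : Ctl U S T p0 p) {r : ℝ} (hr : r ∈ Icc 0 S) : p0 r ∈ Icc 0 T := by
  have e0 : (0:ℝ) ∈ Icc 0 S := ⟨le_rfl, h.pos.le⟩
  have e1 : S ∈ Icc 0 S := ⟨h.pos.le, le_rfl⟩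
  exact ⟨h.h0 ▸ h.mono e0 hr hr.1, h.hT ▸ h.mono hr e1 hr.2⟩

lemma meas (h : Ctl U S T p0 p) (hv : Measurable v) :
    AEMeasurable (fun r => v (p0 r)) (volume.restrict (Ioo 0 S)) :=
  hv.comp_aemeasurable
    ((h.lip0.continuousOn.mono Ioo_subset_Icc_self).aemeasurable measurableSet_Ioo)

lemma meas1 (h : Ctl U S T p0 p) : AEMeasurable p (volume.restrict (Ioo 0 S)) :=
  (h.lip1.continuousOn.mono Ioo_subset_Icc_self).aemeasurable measurableSet_Ioo

/-- integrability of the integrand along arbitrary curves -/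
lemma ii (h : Ctl U S T p0 p) (hst : StandingHyp U V g0 g M) (hv : Measurable v)
    (hvV : ∀ t ∈ Icc 0 T, v t ∈ V) {x : ℝ → Eu n} {u : ℝ → Eu m} {R : ℝ}
    (hx : AEMeasurable x (volume.restrict (Ioo 0 S)))
    (hu : AEMeasurable u (volume.restrict (Ioo 0 S)))
    (hxR : ∀ r ∈ Icc 0 S, ‖x r‖ ≤ R) (huU : ∀ r ∈ Icc 0 S, u r ∈ U) :
    IntervalIntegrable
      (fun r => stF g0 g (deriv p0 r) (deriv p r) (x r) (u r) (v (p0 r))) volume 0 S := by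
  obtain ⟨C, hC, hb⟩ := stF_bound hst
  refine aux_ii h.pos.le (C := C * (1 + R)) ?_ ?_
  · intro r hr
    have hr' := Ioo_subset_Icc_self hr
    refine (hb _ _ _ _ (huU r hr') _ (hvV _ (h.mem hr')) (h.d0 hr) (h.d1 hr)).trans ?_
    have := hxR r hr'
    gcongr
  · exact stF_meas hst (measurable_deriv _) (measurable_deriv _) hx hu (h.meas hv)
      (fun r hr => huU r (Ioo_subset_Icc_self hr))
      (fun r hr => hvV _ (h.mem (Ioo_subset_Icc_self hr)))

lemma frozen (h : Ctl U S T p0 p) (hst : StandingHyp U V g0 g M) (hv : Measurable v)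
    (hvV : ∀ t ∈ Icc 0 T, v t ∈ V) (x : Eu n) {u : Eu m} (hu : u ∈ U) {s : ℝ} (hs : s ∈ Icc 0 S) :
    ∫ r in (0:ℝ)..s, stF g0 g (deriv p0 r) (deriv p r) x u (v (p0 r)) =
      (∫ t in (0:ℝ)..(p0 s), g0 x u (v t)) + ∑ i, (p s i - p 0 i) • g i x u := by
  have hII : ∀ {f : ℝ → Eu n}, IntervalIntegrable f volume 0 S →
      IntervalIntegrable f volume 0 s := by
    intro f hf
    refine hf.mono_set ?_
    rw [uIcc_of_le h.pos.le, uIcc_of_le hs.1]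
    exact Icc_subset_Icc_right hs.2
  have hd : ∀ i : Fin m, IntervalIntegrable (fun r => (deriv p r) i • g i x u) volume 0 s := by
    intro i
    refine hII (aux_ii h.pos.le (C := ‖g i x u‖) ?_ ?_)
    · intro r hr
      rw [norm_smul]
      exact mul_le_of_le_one_left (norm_nonneg _) (aux_coord (h.d1 hr) i)
    · have hbi : Measurable (fun r => deriv p r i) :=
        (EuclideanSpace.proj (𝕜 := ℝ) i).continuous.measurable.comp (measurable_deriv p)
      exact (hbi.smul_const _).aestronglyMeasurable
  have hall := hII (h.ii hst hv hvV (x := fun _ => x) (u := fun _ => u) (R := ‖x‖)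
    aemeasurable_const aemeasurable_const (fun _ _ => le_rfl) (fun _ _ => hu))
  have hsum : IntervalIntegrable (fun r => ∑ i, (deriv p r) i • g i x u) volume 0 s := by
    have := IntervalIntegrable.sum Finset.univ (fun i _ => hd i)
    simpa [Finset.sum_fn] using this
  have h0 : IntervalIntegrable (fun r => deriv p0 r • g0 x u (v (p0 r))) volume 0 s := by
    have := hall.sub hsum
    simpa [stF] using this
  unfold stF
  rw [intervalIntegral.integral_add h0 hsum, aux_cov h.lip0 h.mono (fun t => g0 x u (v t)) hs, h.h0,
    intervalIntegral.integral_finsetSum (fun i _ => hd i)]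
  congr 1
  refine Finset.sum_congr rfl (fun i _ => ?_)
  rw [intervalIntegral.integral_smul_const, aux_ftc h.lip1 i hs]

lemma sol (h : Ctl U S T p0 p) (hst : StandingHyp U V g0 g M) (hv : Measurable v)
    (hvV : ∀ t ∈ Icc 0 T, v t ∈ V) {C : ℝ} (hC : 0 ≤ C)
    (hb : ∀ a b x, ∀ u ∈ U, ∀ w ∈ V, |a| ≤ 1 → ‖b‖ ≤ 1 →
      ‖stF g0 g a b x u w‖ ≤ C * (1 + ‖x‖)) {x0 : Eu n} {xi : ℝ → Eu n}
    (hxi : IsSTSol g0 g x0 p0 p (fun s => v (p0 s)) xi (Icc 0 S)) :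
    ContinuousOn xi (Icc 0 S) ∧ ∀ s ∈ Icc 0 S, ‖xi s‖ ≤ (1 + ‖x0‖) * Real.exp (C * S) := by
  refine (aux_apriori h.pos.le hC
    (f := fun r => stF g0 g (deriv p0 r) (deriv p r) (xi r) (p r) (v (p0 r)))
    hxi ?_ ?_).2
  · intro r hr
    have hr' := Ioo_subset_Icc_self hr
    exact hb _ _ _ _ (h.hU r hr') _ (hvV _ (h.mem hr')) (h.d0 hr) (h.d1 hr)
  · intro hx
    exact stF_meas hst (measurable_deriv _) (measurable_deriv _) hx.aemeasurable h.meas1 (h.meas hv)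
      (fun r hr => h.hU r (Ioo_subset_Icc_self hr))
      (fun r hr => hvV _ (h.mem (Ioo_subset_Icc_self hr)))

lemma frozen_diff (h : Ctl U S T p0 p) (hst : StandingHyp U V g0 g M) (hv : Measurable v)
    (hvV : ∀ t ∈ Icc 0 T, v t ∈ V) (x : Eu n) {u : Eu m} (hu : u ∈ U) :
    ∃ B ≥ (0:ℝ), ∀ (p0' : ℝ → ℝ) (p' : ℝ → Eu m), Ctl U S T p0' p' → ∀ η : ℝ,
      (∀ s ∈ Icc 0 S, |p0' s - p0 s| ≤ η ∧ ‖p' s - p s‖ ≤ η) → ∀ s ∈ Icc 0 S,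
      ‖(∫ r in (0:ℝ)..s, stF g0 g (deriv p0' r) (deriv p' r) x u (v (p0' r))) -
        ∫ r in (0:ℝ)..s, stF g0 g (deriv p0 r) (deriv p r) x u (v (p0 r))‖ ≤ B * η := by
  obtain ⟨C, hC, hb⟩ := stF_gbound hst
  have hTpos : 0 ≤ T := (h.mem ⟨le_rfl, h.pos.le⟩).1.trans (h.mem ⟨le_rfl, h.pos.le⟩).2
  have hVU : v 0 ∈ V := hvV 0 ⟨le_rfl, hTpos⟩
  refine ⟨C * (1 + ‖x‖) * (1 + 2 * m), by positivity, ?_⟩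
  intro p0' p' h' η hη s hs
  have hg0 : IntervalIntegrable (fun t => g0 x u (v t)) volume 0 T := by
    refine aux_ii hTpos (C := C * (1 + ‖x‖)) ?_ ?_
    · intro r hr
      exact (hb x u hu _ (hvV r (Ioo_subset_Icc_self hr))).1
    · refine aux_comp_meas (P := fun r => ((x, u), v r)) hst.2.2.1
        ((MeasurableSet.univ.prod hst.1.measurableSet).prod hst.2.1.measurableSet) ?_ ?_
      · exact (measurable_const.prodMk hv).aemeasurable
      · refine (ae_restrict_iff' measurableSet_Ioo).2 (Eventually.of_forall ?_)
        intro r hr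
        exact ⟨⟨mem_univ _, hu⟩, hvV r (Ioo_subset_Icc_self hr)⟩
  have hsub : ∀ b ∈ Icc 0 T, IntervalIntegrable (fun t => g0 x u (v t)) volume 0 b := by
    intro b hb
    refine hg0.mono_set ?_
    rw [uIcc_of_le hTpos]
    exact uIcc_subset_Icc ⟨le_rfl, hTpos⟩ hb
  rw [h.frozen hst hv hvV x hu hs, h'.frozen hst hv hvV x hu hs, add_sub_add_comm,
    intervalIntegral.integral_interval_sub_left (hsub _ (h'.mem hs)) (hsub _ (h.mem hs)),
    ← Finset.sum_sub_distrib]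
  have b1 : ‖∫ t in (p0 s)..(p0' s), g0 x u (v t)‖ ≤ C * (1 + ‖x‖) * η := by
    have : ‖∫ t in (p0 s)..(p0' s), g0 x u (v t)‖ ≤ C * (1 + ‖x‖) * |p0' s - p0 s| := by
      refine intervalIntegral.norm_integral_le_of_norm_le_const ?_
      intro t ht
      have : t ∈ Icc 0 T := uIcc_subset_Icc (h.mem hs) (h'.mem hs) (uIoc_subset_uIcc ht)
      exact (hb x u hu _ (hvV t this)).1
    refine this.trans ?_
    have := (hη s hs).1
    gcongr
  have b2 : ‖∑ i, ((p' s i - p' 0 i) • g i x u - (p s i - p 0 i) • g i x u)‖ ≤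
      m * (2 * η * (C * (1 + ‖x‖))) := by
    refine (norm_sum_le _ _).trans ?_
    have : ∀ i ∈ (Finset.univ : Finset (Fin m)),
        ‖(p' s i - p' 0 i) • g i x u - (p s i - p 0 i) • g i x u‖ ≤
        2 * η * (C * (1 + ‖x‖)) := by
      intro i _
      have c1 : |p' s i - p s i| ≤ η := aux_coord (hη s hs).2 i
      have c2 : |p' 0 i - p 0 i| ≤ η := aux_coord (hη 0 ⟨le_rfl, h.pos.le⟩).2 i
      have hη0 : 0 ≤ η := (abs_nonneg _).trans c1
      rw [← sub_smul, norm_smul]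
      have c3 := (hb x u hu _ hVU).2 i
      have c4 : ‖(p' s i - p' 0 i) - (p s i - p 0 i)‖ ≤ 2 * η := by
        rw [Real.norm_eq_abs, abs_le]
        rw [abs_le] at c1 c2
        constructor <;> linarith [c1.1, c1.2, c2.1, c2.2]
      gcongr
    refine (Finset.sum_le_sum this).trans ?_
    simp
  refine (norm_add_le _ _).trans ((add_le_add b1 b2).trans (le_of_eq ?_))
  ring

end Ctl

end system
/-- Proposition (second part of Prop. 2.2): uniform convergence, along a subsequence, of
space-time solutions corresponding to uniformly convergent space-time controls. -/
theorem stmt4 {n m q : ℕ}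
    (U : Set (EuclideanSpace ℝ (Fin m))) (V : Set (EuclideanSpace ℝ (Fin q)))
    (g0 : EuclideanSpace ℝ (Fin n) → EuclideanSpace ℝ (Fin m) → EuclideanSpace ℝ (Fin q) →
      EuclideanSpace ℝ (Fin n))
    (g : Fin m → EuclideanSpace ℝ (Fin n) → EuclideanSpace ℝ (Fin m) →
      EuclideanSpace ℝ (Fin n))
    (M : ℝ) (hst : StandingHyp U V g0 g M)
    (x0 : EuclideanSpace ℝ (Fin n)) (St Tt : ℝ) (hSt : 0 < St) (hTt : 0 < Tt)
    -- the limit space-time control (φ₀,φ)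
    (phi0 : ℝ → ℝ) (phi : ℝ → EuclideanSpace ℝ (Fin m))
    (hlip : ∀ s1 ∈ Icc (0:ℝ) St, ∀ s2 ∈ Icc (0:ℝ) St,
      |phi0 s1 - phi0 s2| + ‖phi s1 - phi s2‖ ≤ |s1 - s2|)
    (hmono : MonotoneOn phi0 (Icc 0 St)) (h00 : phi0 0 = 0) (hST : phi0 St = Tt)
    (hae : ∀ᵐ s ∂volume, s ∈ Ioo (0:ℝ) St → deriv phi0 s + ‖deriv phi s‖ = 1)
    (hphiU : ∀ s ∈ Icc (0:ℝ) St, phi s ∈ U)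
    -- the ordinary control v
    (v : ℝ → EuclideanSpace ℝ (Fin q)) (hvmeas : Measurable v)
    (hvV : ∀ t ∈ Icc (0:ℝ) Tt, v t ∈ V)
    -- the approximating space-time controls (φ₀ₕ,φₕ)
    (phi0h : ℕ → ℝ → ℝ) (phih : ℕ → ℝ → EuclideanSpace ℝ (Fin m))
    (hliph : ∀ h, ∀ s1 ∈ Icc (0:ℝ) St, ∀ s2 ∈ Icc (0:ℝ) St,
      |phi0h h s1 - phi0h h s2| + ‖phih h s1 - phih h s2‖ ≤ |s1 - s2|)
    (hsmh : ∀ h, StrictMonoOn (phi0h h) (Icc 0 St))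
    (h00h : ∀ h, phi0h h 0 = 0) (hSTh : ∀ h, phi0h h St = Tt)
    (hphiUh : ∀ h, ∀ s ∈ Icc (0:ℝ) St, phih h s ∈ U)
    -- uniform convergence of the controls on [0,S̃]
    (hunif : TendstoUniformlyOn (fun h s => (phi0h h s, phih h s))
      (fun s => (phi0 s, phi s)) atTop (Icc 0 St))
    -- the corresponding space-time solutions
    (xi : ℝ → EuclideanSpace ℝ (Fin n))
    (hxi : IsSTSol g0 g x0 phi0 phi (fun s => v (phi0 s)) xi (Icc 0 St))
    (xih : ℕ → ℝ → EuclideanSpace ℝ (Fin n))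
    (hxih : ∀ h, IsSTSol g0 g x0 (phi0h h) (phih h) (fun s => v (phi0h h s))
      (xih h) (Icc 0 St)) :
    -- a subsequence of (ξₕ) converges uniformly to ξ on [0,S̃]
    ∃ k : ℕ → ℕ, StrictMono k ∧
      TendstoUniformlyOn (fun h => xih (k h)) xi atTop (Icc 0 St) := by
  have hc0 : Ctl U St Tt phi0 phi := ⟨hSt, hlip, hmono, h00, hST, hphiU⟩
  have hch : ∀ h, Ctl U St Tt (phi0h h) (phih h) := fun h =>
    ⟨hSt, hliph h, (hsmh h).monotoneOn, h00h h, hSTh h, hphiUh h⟩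
  obtain ⟨C, hC, hb⟩ := stF_bound hst
  obtain ⟨hxc, hxR⟩ := hc0.sol hst hvmeas hvV hC hb hxi
  have hxhc := fun h => ((hch h).sol hst hvmeas hvV hC hb (hxih h)).1
  have hxhR := fun h => ((hch h).sol hst hvmeas hvV hC hb (hxih h)).2
  set R := (1 + ‖x0‖) * Real.exp (C * St) with hRdef
  have hR : 0 < R := by positivity
  obtain ⟨L, hL, hLip⟩ := stF_lip hst R hR
  have hxm : AEMeasurable xi (volume.restrict (Ioo 0 St)) :=
    (hxc.mono Ioo_subset_Icc_self).aemeasurable measurableSet_Ioo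
  have hxhm : ∀ h, AEMeasurable (xih h) (volume.restrict (Ioo 0 St)) := fun h =>
    ((hxhc h).mono Ioo_subset_Icc_self).aemeasurable measurableSet_Ioo
  have e0 : (0:ℝ) ∈ Icc 0 St := ⟨le_rfl, hSt.le⟩
  have hsub : ∀ {f : ℝ → EuclideanSpace ℝ (Fin n)}, IntervalIntegrable f volume 0 St →
      ∀ a ∈ Icc 0 St, ∀ b ∈ Icc 0 St, IntervalIntegrable f volume a b := by
    intro f hf a ha b hb
    refine hf.mono_set ?_
    rw [uIcc_of_le hSt.le]
    exact uIcc_subset_Icc ha hb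
  -- the three integrands
  have iX := hc0.ii hst hvmeas hvV hxm hc0.meas1 hxR hphiU
  have iH := fun h => (hch h).ii hst hvmeas hvV (hxhm h) (hch h).meas1 (hxhR h) (hphiUh h)
  have iM := fun h => (hch h).ii hst hvmeas hvV hxm hc0.meas1 hxR hphiU
  -- xi is Lipschitz
  have hxLip1 : ∀ s ∈ Icc 0 St, ∀ t ∈ Icc 0 St, s ≤ t → ‖xi t - xi s‖ ≤ C * (1 + R) * (t - s) := by
    intro s hs t ht hst'
    have e : xi t - xi s = ∫ r in s..t,
        stF g0 g (deriv phi0 r) (deriv phi r) (xi r) (phi r) (v (phi0 r)) := by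
      rw [hxi t ht, hxi s hs, add_sub_add_left_eq_sub]
      exact intervalIntegral.integral_interval_sub_left (hsub iX 0 e0 t ht) (hsub iX 0 e0 s hs)
    rw [e]
    refine aux_norm_int hst' ?_
    intro r hr
    have hr' : r ∈ Ioo 0 St := ⟨lt_of_le_of_lt hs.1 hr.1, hr.2.trans_le ht.2⟩
    have hr'' := Ioo_subset_Icc_self hr'
    refine (hb _ _ _ _ (hphiU r hr'') _ (hvV _ (hc0.mem hr'')) (hc0.d0 hr') (hc0.d1 hr')).trans ?_
    have := hxR r hr''
    gcongr
  have hxLip : ∀ s ∈ Icc 0 St, ∀ t ∈ Icc 0 St, ‖xi s - xi t‖ ≤ C * (1 + R) * |s - t| := by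
    intro s hs t ht
    rcases le_total s t with hle | hle
    · rw [norm_sub_rev, abs_sub_comm, abs_of_nonneg (sub_nonneg.2 hle)]
      exact hxLip1 s hs t ht hle
    · rw [abs_of_nonneg (sub_nonneg.2 hle)]
      exact hxLip1 t ht s hs hle
  -- uniform convergence of controls
  have hctl : ∀ η > 0, ∀ᶠ h in atTop, ∀ s ∈ Icc 0 St,
      |phi0h h s - phi0 s| ≤ η ∧ ‖phih h s - phi s‖ ≤ η := by
    intro η hη
    filter_upwards [Metric.tendstoUniformlyOn_iff.1 hunif η hη] with h hh s hs
    have := hh s hs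
    rw [dist_comm, Prod.dist_eq, max_lt_iff, Real.dist_eq, dist_eq_norm] at this
    exact ⟨this.1.le, this.2.le⟩
  have fii : ∀ {p0 : ℝ → ℝ} {p : ℝ → EuclideanSpace ℝ (Fin m)}, Ctl U St Tt p0 p →
      ∀ τ ∈ Icc 0 St, IntervalIntegrable (fun r => stF g0 g (deriv p0 r) (deriv p r)
        (xi τ) (phi τ) (v (p0 r))) volume 0 St := by
    intro p0 p hp τ hτ
    exact hp.ii hst hvmeas hvV (x := fun _ => xi τ) (u := fun _ => phi τ) (R := R)
      aemeasurable_const aemeasurable_const (fun _ _ => hxR τ hτ) (fun _ _ => hphiU τ hτ)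
  have flip : ∀ {p0 : ℝ → ℝ} {p : ℝ → EuclideanSpace ℝ (Fin m)}, Ctl U St Tt p0 p →
      ∀ τ ∈ Icc 0 St, ∀ τ' ∈ Icc 0 St, ∀ r ∈ Ioo 0 St,
      ‖stF g0 g (deriv p0 r) (deriv p r) (xi τ) (phi τ) (v (p0 r)) -
        stF g0 g (deriv p0 r) (deriv p r) (xi τ') (phi τ') (v (p0 r))‖ ≤
        L * (C * (1 + R) + 1) * |τ - τ'| := by
    intro p0 p hp τ hτ τ' hτ' r hr
    refine (hLip _ _ _ _ _ (hphiU τ hτ) _ (hphiU τ' hτ') _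
      (hvV _ (hp.mem (Ioo_subset_Icc_self hr))) (hp.d0 hr) (hp.d1 hr)
      (hxR τ hτ) (hxR τ' hτ')).trans ?_
    rw [mul_assoc]
    refine mul_le_mul_of_nonneg_left ?_ hL
    have h1 := hxLip τ hτ τ' hτ'
    have h2 := hlip τ hτ τ' hτ'
    have h3 := abs_nonneg (phi0 τ - phi0 τ')
    linarith
  have hE := aux_freeze hSt (C := 2 * (L * (C * (1 + R) + 1))) (by positivity)
    (fun h τ r => stF g0 g (deriv (phi0h h) r) (deriv (phih h) r) (xi τ) (phi τ) (v (phi0h h r)) -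
      stF g0 g (deriv phi0 r) (deriv phi r) (xi τ) (phi τ) (v (phi0 r)))
    (by
      intro h τ hτ τ' hτ' r hr
      have h1 := flip (hch h) τ hτ τ' hτ' r hr
      have h2 := flip hc0 τ hτ τ' hτ' r hr
      rw [sub_sub_sub_comm]
      refine (norm_sub_le _ _).trans ?_
      linarith)
    (fun h τ hτ => (fii (hch h) τ hτ).sub (fii hc0 τ hτ))
    (fun h => (iM h).sub iX)
    (by
      intro τ hτ ε hε
      obtain ⟨B, hB, hBd⟩ := hc0.frozen_diff hst hvmeas hvV (xi τ) (hphiU τ hτ)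
      filter_upwards [hctl (ε / (B + 1)) (by positivity)] with h hh s hs
      rw [intervalIntegral.integral_sub (hsub (fii (hch h) τ hτ) 0 e0 s hs)
        (hsub (fii hc0 τ hτ) 0 e0 s hs)]
      refine (hBd _ _ (hch h) _ hh s hs).trans ?_
      rw [mul_div_assoc', div_le_iff₀ (by positivity)]
      nlinarith)
  refine ⟨id, strictMono_id, ?_⟩
  rw [Metric.tendstoUniformlyOn_iff]
  intro ε hε
  set Q := (1 + L * St) * Real.exp (L * St) with hQ
  have hQp : 0 < Q := by positivity
  set η := ε / (2 * Q) with hηdef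
  have hη : 0 < η := by positivity
  filter_upwards [hE η hη, hctl η hη] with h h1 h2 s hs
  rw [dist_comm, dist_eq_norm]
  have hec : ContinuousOn (fun r => ‖xih h r - xi r‖) (Icc 0 St) := ((hxhc h).sub hxc).norm
  have hgr := aux_gronwall (A := η * (1 + L * St)) hL hec (fun _ _ => norm_nonneg _) (by
    intro t ht
    have hi : IntervalIntegrable (fun r => ‖xih h r - xi r‖) volume 0 t := by
      refine ContinuousOn.intervalIntegrable ?_
      rw [uIcc_of_le ht.1]
      exact hec.mono (Icc_subset_Icc_right ht.2)
    have eq1 : xih h t - xi t = (∫ r in (0:ℝ)..t,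
        (stF g0 g (deriv (phi0h h) r) (deriv (phih h) r) (xih h r) (phih h r) (v (phi0h h r)) -
         stF g0 g (deriv (phi0h h) r) (deriv (phih h) r) (xi r) (phi r) (v (phi0h h r)))) +
        ∫ r in (0:ℝ)..t,
        (stF g0 g (deriv (phi0h h) r) (deriv (phih h) r) (xi r) (phi r) (v (phi0h h r)) -
         stF g0 g (deriv phi0 r) (deriv phi r) (xi r) (phi r) (v (phi0 r))) := by
      rw [intervalIntegral.integral_sub (hsub (iH h) 0 e0 t ht) (hsub (iM h) 0 e0 t ht),
        intervalIntegral.integral_sub (hsub (iM h) 0 e0 t ht) (hsub iX 0 e0 t ht),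
        sub_add_sub_cancel, hxih h t ht, hxi t ht, add_sub_add_left_eq_sub]
      rfl
    have b1 : ‖∫ r in (0:ℝ)..t,
        (stF g0 g (deriv (phi0h h) r) (deriv (phih h) r) (xih h r) (phih h r) (v (phi0h h r)) -
         stF g0 g (deriv (phi0h h) r) (deriv (phih h) r) (xi r) (phi r) (v (phi0h h r)))‖ ≤
        ∫ r in (0:ℝ)..t, (L * ‖xih h r - xi r‖ + L * η) := by
      refine intervalIntegral.norm_integral_le_of_norm_le ht.1 (aux_ae_Ioo ?_)
        ((hi.const_mul L).add intervalIntegrable_const)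
      intro r hr
      have hr' : r ∈ Ioo 0 St := ⟨hr.1, hr.2.trans_le ht.2⟩
      have hr'' := Ioo_subset_Icc_self hr'
      refine (hLip _ _ _ _ _ (hphiUh h r hr'') _ (hphiU r hr'') _
        (hvV _ ((hch h).mem hr'')) ((hch h).d0 hr') ((hch h).d1 hr')
        (hxhR h r hr'') (hxR r hr'')).trans ?_
      rw [← mul_add]
      have := (h2 r hr'').2
      gcongr
    rw [intervalIntegral.integral_add (hi.const_mul L) intervalIntegrable_const,
      intervalIntegral.integral_const_mul, intervalIntegral.integral_const, sub_zero,
      smul_eq_mul] at b1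
    have b2 := h1 t ht
    rw [eq1]
    refine (norm_add_le _ _).trans ?_
    have b3 : t * (L * η) ≤ St * (L * η) := by
      have := ht.2
      gcongr
    linarith) s hs
  refine lt_of_le_of_lt hgr ?_
  have hex : Real.exp (L * s) ≤ Real.exp (L * St) := by
    have := mul_le_mul_of_nonneg_left hs.2 hL
    gcongr
  calc η * (1 + L * St) * Real.exp (L * s) ≤ η * (1 + L * St) * Real.exp (L * St) := by gcongr
    _ = η * Q := by rw [hQ]; ring
    _ = ε / 2 := by rw [hηdef]; field_simp
    _ < ε := by linarith

end
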